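/- Let w^F be a γ-balanced weight assignment of an unweighted multi-hypergraph H = (V, E) with |V| = n ≥ 2 (every hyperedge of size at least 2), let ε ∈ (0,1], let d ≥ 1 be an integer, set ρ := 8(d+6)γ²·(log n)/(0.38·ε²), and for each e ∈ E set p_e := min(1, ρ/κ_e). Include each hyperedge e ∈ E in Ê independently with probability p_e, with weight ŵ(e) := 1/p_e if included. Fix an integer i ≥ 0. Then with probability at least 1 − 4n^{−(d+1)}, for every cut ∅ ⊊ S ⊊ V: |Σ_{e ∈ Ê ∩ E_i ∩ δ_H(S)} ŵ(e) − |E_i ∩ δ_H(S)|| ≤ (ε/γ)·Σ_{e ∈ E_{≥i}^max ∩ δ_H(S)} w_i^E(e). -/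

import Mathlib

open Finset
open scoped Classical

/-- An edge `f` crosses the cut `S` if exactly one of its endpoints lies in `S`. -/
def crossesCut {V F : Type} (ep : F → V × V) (S : Finset V) (f : F) : Prop :=
  ((ep f).1 ∈ S ∧ (ep f).2 ∉ S) ∨ ((ep f).1 ∉ S ∧ (ep f).2 ∈ S)

/-- Total weight of edges of the induced subgraph `G[X]` crossing the cut `S`. -/
noncomputable def cutWt {V F : Type} [Fintype F] (ep : F → V × V) (w : F → ℝ)
    (X S : Finset V) : ℝ :=
  ∑ f : F, if (ep f).1 ∈ X ∧ (ep f).2 ∈ X ∧ crossesCut ep S f then w f else 0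

/-- The min-cut of the induced subgraph `G[X]`: the least total weight of edges of `G[X]`
crossing a cut `(S, X \ S)` with `∅ ⊊ S ⊊ X`. -/
noncomputable def minCutIn {V F : Type} [Fintype F] (ep : F → V × V) (w : F → ℝ)
    (X : Finset V) : ℝ :=
  sInf {c : ℝ | ∃ S : Finset V, S ⊆ X ∧ S.Nonempty ∧ S ≠ X ∧ c = cutWt ep w X S}

/-- The strength of an edge `f`: the maximum of the min-cut of `G[X]` over all vertex
sets `X` containing both endpoints of `f`. -/
noncomputable def strength {V F : Type} [Fintype V] [Fintype F] (ep : F → V × V)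
    (w : F → ℝ) (f : F) : ℝ :=
  sSup {c : ℝ | ∃ X : Finset V, (ep f).1 ∈ X ∧ (ep f).2 ∈ X ∧ c = minCutIn ep w X}


/-- A hyperedge `e` crosses the cut `S` if it has at least one vertex in `S` and at least
one vertex outside `S`. -/
def hCrosses {V E : Type} (he : E → Finset V) (S : Finset V) (e : E) : Prop :=
  ((he e) ∩ S).Nonempty ∧ ((he e) \ S).Nonempty

/-- The (multiset) union over the hyperedges `e` of the edge set `F_e` of the clique on the
vertex set of `e`: an element records the hyperedge `e` and an unordered pair of distinct
vertices of `e` (normalized so that the first vertex is smaller). -/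
abbrev CliqueEdges {V E : Type} [LinearOrder V] (he : E → Finset V) : Type :=
  {p : E × V × V // p.2.1 ∈ he p.1 ∧ p.2.2 ∈ he p.1 ∧ p.2.1 < p.2.2}

/-- The endpoints of a clique edge. -/
def cep {V E : Type} [LinearOrder V] (he : E → Finset V) : CliqueEdges he → V × V :=
  fun f => f.1.2

/-- `κ_e`: the minimum strength of an edge of the clique `F_e` in the auxiliary graph
`G = (V, F, w)`. -/
noncomputable def kappa {V E : Type} [Fintype V] [LinearOrder V] [Fintype E]
    (he : E → Finset V) (w : CliqueEdges he → ℝ) (e : E) : ℝ :=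
  sInf {c : ℝ | ∃ f : CliqueEdges he, f.1.1 = e ∧ c = strength (cep he) w f}

/-- `κ_e^max`: the maximum strength of a positive-weight edge of the clique `F_e` in the
auxiliary graph `G = (V, F, w)`. -/
noncomputable def kappaMax {V E : Type} [Fintype V] [LinearOrder V] [Fintype E]
    (he : E → Finset V) (w : CliqueEdges he → ℝ) (e : E) : ℝ :=
  sSup {c : ℝ | ∃ f : CliqueEdges he, f.1.1 = e ∧ 0 < w f ∧ c = strength (cep he) w f}

/-- A weight assignment `w : F → ℝ≥0` is `γ`-balanced if for each hyperedge `e` the weights of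
the clique `F_e` sum to `1` and `κ_e^max ≤ γ·κ_e`. -/
def BalancedAssignment {V E : Type} [Fintype V] [LinearOrder V] [Fintype E]
    (he : E → Finset V) (w : CliqueEdges he → ℝ) (γ : ℝ) : Prop :=
  ∀ e : E, (∑ f : CliqueEdges he, if f.1.1 = e then w f else 0) = 1 ∧
    kappaMax he w e ≤ γ * kappa he w e

/-- The probability that the independent sampling with inclusion probabilities `p` produces
exactly the set `A` of hyperedges. -/
noncomputable def sampleProb {E : Type} [Fintype E] [DecidableEq E]
    (p : E → ℝ) (A : Finset E) : ℝ :=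
  (∏ e ∈ A, p e) * ∏ e ∈ Aᶜ, (1 - p e)


/-- Edges separated by `S`. -/
noncomputable def dl {V F : Type} [Fintype F] (s t : F → V) (S : Finset V) : Finset F :=
  Finset.univ.filter (fun f => ¬ (s f ∈ S ↔ t f ∈ S))

theorem mem_dl {V F : Type} [Fintype F] (s t : F → V) (S : Finset V) (f : F) :
    f ∈ dl s t S ↔ ¬ (s f ∈ S ↔ t f ∈ S) := by simp [dl]

noncomputable def mrg {V : Type} (u v : V) (h : u ≠ v) (x : V) : {x : V // x ≠ v} :=
  if hx : x = v then ⟨u, h⟩ else ⟨x, hx⟩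

noncomputable def cuts {V F : Type} [Fintype V] [Fintype F] (s t : F → V) (w : F → ℝ) (b : ℝ) :
    Finset (Finset F) :=
  (Finset.univ.image (dl s t)).filter (fun D => ∑ f ∈ D, w f ≤ b)

theorem mem_cuts {V F : Type} [Fintype V] [Fintype F] (s t : F → V) (w : F → ℝ) (b : ℝ)
    (D : Finset F) : D ∈ cuts s t w b ↔ (∃ S, dl s t S = D) ∧ ∑ f ∈ D, w f ≤ b := by
  simp [cuts]

theorem dl_mrg_exists {V F : Type} [Fintype V] [Fintype F] (s t : F → V) (u v : V) (h : u ≠ v)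
    (S : Finset V) (hS : u ∈ S ↔ v ∈ S) :
    ∃ S' : Finset {x : V // x ≠ v}, dl (fun f => mrg u v h (s f)) (fun f => mrg u v h (t f)) S'
      = dl s t S := by
  refine ⟨Finset.univ.filter (fun x => (x : V) ∈ S), ?_⟩
  have key : ∀ x, mrg u v h x ∈ Finset.univ.filter (fun x : {x : V // x ≠ v} => (x : V) ∈ S)
      ↔ x ∈ S := by
    intro x
    unfold mrg
    split_ifs with hx
    · subst hx; simpa using hS
    · simp
  ext f
  rw [mem_dl, mem_dl, key, key]

theorem dl_of_mrg {V F : Type} [Fintype V] [Fintype F] (s t : F → V) (u v : V) (h : u ≠ v)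
    (S' : Finset {x : V // x ≠ v}) :
    ∃ S : Finset V, dl (fun f => mrg u v h (s f)) (fun f => mrg u v h (t f)) S'
      = dl s t S := by
  refine ⟨Finset.univ.filter (fun x => mrg u v h x ∈ S'), ?_⟩
  ext f
  simp [mem_dl]

theorem cut_count {F : Type} [Fintype F] (w : F → ℝ) (hw : ∀ f, 0 ≤ w f) (c : ℝ) (hc : 0 < c)
    (k : ℕ) (hk : 1 ≤ k) (r : ℕ) (hr : k ≤ r) :
    ∀ (V : Type) [Fintype V] (s t : F → V), Fintype.card V = r →
      (∀ S, dl s t S = ∅ ∨ c ≤ ∑ f ∈ dl s t S, w f) →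
      (cuts s t w (k * c / 2)).card ≤ 2 ^ k * r.choose k := by
  induction r, hr using Nat.le_induction with
  | base =>
    intro V _ s t hV _
    rw [Nat.choose_self, mul_one]
    unfold cuts
    refine (Finset.card_filter_le _ _).trans (Finset.card_image_le.trans ?_)
    simp [hV]
  | succ r hr ih =>
    intro V _ s t hV hcut
    have hcard : ∀ v : V, Fintype.card {x : V // x ≠ v} = r := by
      intro v
      rw [Fintype.card_subtype_compl]; simp [hV]
    have step : ∀ (u v : V) (h : u ≠ v),
        (cuts (fun f => mrg u v h (s f)) (fun f => mrg u v h (t f)) w (k * c / 2)).card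
          ≤ 2 ^ k * r.choose k := by
      intro u v h
      apply ih _ _ _ (hcard v)
      intro S'
      obtain ⟨S, hS⟩ := dl_of_mrg s t u v h S'
      rw [hS]; exact hcut S
    by_cases hiso : ∃ v, dl s t {v} = ∅
    · obtain ⟨v, hv⟩ := hiso
      have hv' : ∀ f, s f = v ↔ t f = v := by
        intro f
        have : f ∉ dl s t {v} := by rw [hv]; simp
        simpa [mem_dl] using this
      have : 1 < Fintype.card V := by omega
      obtain ⟨u, hu⟩ := Fintype.exists_ne_of_one_lt_card this v
      have hsub : cuts s t w (k * c / 2) ⊆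
          cuts (fun f => mrg u v hu (s f)) (fun f => mrg u v hu (t f)) w (k * c / 2) := by
        intro D hD
        rw [mem_cuts] at hD ⊢
        obtain ⟨⟨S, hS⟩, hD⟩ := hD
        refine ⟨?_, hD⟩
        obtain ⟨S', hS'⟩ := dl_mrg_exists s t u v hu
          (Finset.univ.filter (fun x => if x = v then u ∈ S else x ∈ S)) (by simp [hu])
        refine ⟨S', ?_⟩
        rw [hS', ← hS]
        ext f
        simp only [mem_dl, Finset.mem_filter, Finset.mem_univ, true_and]
        have := hv' f
        by_cases h1 : s f = v
        · have h2 := this.1 h1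
          simp [h1, h2]
        · have h2 : t f ≠ v := fun h => h1 (this.2 h)
          simp [h1, h2]
      refine (Finset.card_le_card hsub).trans ((step u v hu).trans ?_)
      exact Nat.mul_le_mul_left _ (Nat.choose_le_choose k (Nat.le_succ r))
    · push Not at hiso
      set N := cuts s t w (k * c / 2) with hN
      set nl : Finset F := Finset.univ.filter (fun f => s f ≠ t f) with hnl
      set W := ∑ f ∈ nl, w f with hW
      have hW2 : ((r : ℝ) + 1) * c ≤ 2 * W := by
        have h1 : ∀ v : V, c ≤ ∑ f ∈ dl s t {v}, w f := fun v =>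
          (hcut {v}).resolve_left (hiso v |>.ne_empty)
        have h2 : ∑ v : V, c ≤ ∑ v : V, ∑ f ∈ dl s t {v}, w f := Finset.sum_le_sum fun v _ => h1 v
        have h3 : ∑ v : V, ∑ f ∈ dl s t {v}, w f = ∑ f ∈ nl, 2 * w f := by
          simp only [dl, hnl, Finset.sum_filter]
          rw [Finset.sum_comm]
          apply Finset.sum_congr rfl
          intro f _
          by_cases h : s f = t f
          · simp [h]
          · rw [if_pos h]
            have : ∀ v : V, (if ¬ (s f ∈ ({v} : Finset V) ↔ t f ∈ ({v} : Finset V)) then w f else 0)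
              = (if v = s f then w f else 0) + (if v = t f then w f else 0) := by
              intro v
              by_cases h1 : v = s f
              · subst h1; simp [Ne.symm h, h]
              · by_cases h2 : v = t f
                · subst h2; simp [h, Ne.symm h]
                · simp [h1, h2, Ne.symm h1, Ne.symm h2]
            simp only [this, Finset.sum_add_distrib, Finset.sum_ite_eq', Finset.mem_univ, if_true]
            ring
        rw [h3, ← Finset.mul_sum] at h2
        simpa [hV] using h2
      have hWpos : 0 < W := by
        have : 0 < ((r : ℝ) + 1) * c := by positivity
        linarith
      have hmem : ∀ D ∈ N, ∑ f ∈ nl, (if f ∈ D then 0 else w f) = W - ∑ f ∈ D, w f := by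
        intro D hD
        rw [hN, mem_cuts] at hD
        obtain ⟨⟨S, hS⟩, _⟩ := hD
        have hsub : D ⊆ nl := by
          intro f hf
          rw [← hS, mem_dl] at hf
          simp only [hnl, Finset.mem_filter, Finset.mem_univ, true_and]
          intro h; apply hf; rw [h]
        have : ∑ f ∈ D, w f = ∑ f ∈ nl, if f ∈ D then w f else 0 := by
          rw [← Finset.sum_filter]
          congr 1
          ext f; simp only [Finset.mem_filter]; exact ⟨fun h => ⟨hsub h, h⟩, fun h => h.2⟩
        rw [this, hW, ← Finset.sum_sub_distrib]
        apply Finset.sum_congr rfl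
        intro f _
        split_ifs <;> simp
      have hup : ∑ D ∈ N, ∑ f ∈ nl, (if f ∈ D then 0 else w f) ≤ W * (2 ^ k * r.choose k : ℕ) := by
        rw [Finset.sum_comm, hW, Finset.sum_mul]
        apply Finset.sum_le_sum
        intro f hf
        have hne : s f ≠ t f := by simpa [hnl] using hf
        have : ∑ D ∈ N, (if f ∈ D then 0 else w f) = w f * ((N.filter (fun D => f ∉ D)).card : ℝ) := by
          rw [mul_comm, ← nsmul_eq_mul, ← Finset.sum_const, Finset.sum_filter]
          apply Finset.sum_congr rfl
          intro D _
          split_ifs <;> simp_all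
        rw [this]
        apply mul_le_mul_of_nonneg_left _ (hw f)
        refine Nat.cast_le.2 (le_trans (Finset.card_le_card ?_) (step (s f) (t f) hne))
        intro D hD
        rw [Finset.mem_filter, hN, mem_cuts] at hD
        obtain ⟨⟨⟨S, hS⟩, hle⟩, hfD⟩ := hD
        rw [mem_cuts]
        refine ⟨?_, hle⟩
        rw [← hS, mem_dl, not_not] at hfD
        obtain ⟨S', hS'⟩ := dl_mrg_exists s t (s f) (t f) hne S hfD
        exact ⟨S', hS'.trans hS⟩
      have hlow : (N.card : ℝ) * (W - k * c / 2) ≤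
          ∑ D ∈ N, ∑ f ∈ nl, (if f ∈ D then 0 else w f) := by
        rw [← nsmul_eq_mul, ← Finset.sum_const]
        apply Finset.sum_le_sum
        intro D hD
        rw [hmem D hD]
        rw [hN, mem_cuts] at hD
        linarith [hD.2]
      have hch := Nat.choose_mul_succ_eq r k
      have hch' : ((r.choose k : ℝ)) * (r + 1) = ((r+1).choose k : ℝ) * ((r : ℝ) + 1 - k) := by
        have : ((r + 1 - k : ℕ) : ℝ) = (r : ℝ) + 1 - k := by
          rw [Nat.cast_sub (by omega)]; push_cast; ring
        rw [← this]; exact_mod_cast hch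
      have hkr : (0:ℝ) < (r : ℝ) + 1 - k := by
        have : (k : ℝ) ≤ r := by exact_mod_cast hr
        linarith
      have h1 : (N.card : ℝ) * (W * ((r:ℝ) + 1 - k)) ≤ W * (2 ^ k * r.choose k : ℕ) * (r + 1) := by
        have h2 : W * ((r:ℝ) + 1 - k) ≤ (W - k * c / 2) * (r + 1) := by
          have : (k:ℝ) * (((r : ℝ) + 1) * c) ≤ k * (2 * W) := by gcongr
          nlinarith
        calc (N.card : ℝ) * (W * ((r:ℝ) + 1 - k)) ≤ N.card * ((W - k * c / 2) * (r + 1)) := by gcongr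
          _ = N.card * (W - k * c / 2) * (r + 1) := by ring
          _ ≤ _ := mul_le_mul_of_nonneg_right (hlow.trans hup) (by positivity)
      have h2 : (N.card : ℝ) * (W * ((r:ℝ) + 1 - k)) ≤
          (2 ^ k * (r+1).choose k : ℝ) * (W * ((r:ℝ) + 1 - k)) := by
        refine h1.trans (le_of_eq ?_)
        push_cast
        linear_combination W * 2 ^ k * hch'
      have h3 := le_of_mul_le_mul_right h2 (by positivity)
      exact_mod_cast h3

theorem cut_count' {V F : Type} [Fintype V] [Fintype F] (w : F → ℝ) (hw : ∀ f, 0 ≤ w f) (c : ℝ)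
    (hc : 0 < c) (k : ℕ) (hk : 1 ≤ k) (s t : F → V) (hV : 2 ≤ Fintype.card V)
    (hcut : ∀ S, dl s t S = ∅ ∨ c ≤ ∑ f ∈ dl s t S, w f) :
      (cuts s t w (k * c / 2)).card ≤ (Fintype.card V) ^ (2 * k) := by
  have h2 : 2 ^ k ≤ (Fintype.card V) ^ k := Nat.pow_le_pow_left hV k
  have h1 : 1 ≤ (Fintype.card V) ^ k := Nat.one_le_pow _ _ (by omega)
  rw [two_mul, pow_add]
  by_cases hr : k ≤ Fintype.card V
  · refine (cut_count w hw c hc k hk _ hr V s t rfl hcut).trans ?_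
    exact Nat.mul_le_mul h2 (Nat.choose_le_pow _ _)
  · have : (cuts s t w (k * c / 2)).card ≤ 2 ^ k := by
      unfold cuts
      refine (Finset.card_filter_le _ _).trans (Finset.card_image_le.trans ?_)
      simp only [Finset.card_univ, Fintype.card_finset]
      exact Nat.pow_le_pow_right (by norm_num) (by omega)
    nlinarith

theorem sampleProb_nonneg {E : Type} [Fintype E] [DecidableEq E] (p : E → ℝ)
    (h0 : ∀ e, 0 ≤ p e) (h1 : ∀ e, p e ≤ 1) (A : Finset E) : 0 ≤ sampleProb p A :=
  mul_nonneg (Finset.prod_nonneg fun e _ => h0 e)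
    (Finset.prod_nonneg fun e _ => sub_nonneg.2 (h1 e))

theorem sampleProb_mgf {E : Type} [Fintype E] [DecidableEq E] (p a b : E → ℝ) :
    ∑ A : Finset E, sampleProb p A * ((∏ e ∈ A, a e) * ∏ e ∈ Aᶜ, b e) =
      ∏ e, (p e * a e + (1 - p e) * b e) := by
  rw [Finset.prod_add, Finset.powerset_univ]
  apply Finset.sum_congr rfl
  intro A _
  rw [sampleProb, Finset.prod_mul_distrib, Finset.prod_mul_distrib, ← Finset.compl_eq_univ_sdiff]
  ring

theorem sampleProb_sum {E : Type} [Fintype E] [DecidableEq E] (p : E → ℝ) :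
    ∑ A : Finset E, sampleProb p A = 1 := by
  have := sampleProb_mgf p (fun _ => 1) (fun _ => 1)
  simpa using this

theorem mgf_one (p L l : ℝ) (h0 : 0 < p) (h1 : p ≤ 1) (hL : 1 / p ≤ L) (hl : |l| ≤ 1 / L) :
    p * Real.exp (l * (1 / p - 1)) + (1 - p) * Real.exp (l * (-1)) ≤ Real.exp (l ^ 2 * L) := by
  have hp1 : 1 ≤ 1 / p := by rw [le_div_iff₀ h0]; linarith
  have hL0 : 0 < L := by linarith
  have hl' : |l| * L ≤ 1 := by rwa [le_div_iff₀ hL0] at hl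
  have ex : ∀ x : ℝ, |x| ≤ 1 → Real.exp x ≤ 1 + x + x ^ 2 := by
    intro x hx
    have := (abs_le.1 (Real.abs_exp_sub_one_sub_id_le hx)).2
    linarith
  have e1 := ex (l * (1 / p - 1)) (by
    rw [abs_mul, abs_of_nonneg (by linarith : (0:ℝ) ≤ 1 / p - 1)]
    refine le_trans (mul_le_mul_of_nonneg_left ?_ (abs_nonneg l)) hl'
    linarith)
  have e2 := ex (l * (-1)) (by
    rw [abs_mul]; norm_num
    refine le_trans ?_ hl'
    nlinarith [abs_nonneg l])
  calc p * Real.exp (l * (1 / p - 1)) + (1 - p) * Real.exp (l * (-1))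
      ≤ p * (1 + l * (1 / p - 1) + (l * (1 / p - 1)) ^ 2) + (1 - p) * (1 + l * (-1) + (l * (-1)) ^ 2) := by
        gcongr
    _ = 1 + l ^ 2 * (1 / p - 1) := by field_simp; ring
    _ ≤ 1 + l ^ 2 * L := by gcongr; linarith
    _ ≤ _ := by linarith [Real.add_one_le_exp (l ^ 2 * L)]

theorem mgf_all {E : Type} [Fintype E] [DecidableEq E] (p : E → ℝ)
    (h0 : ∀ e, 0 ≤ p e) (h1 : ∀ e, p e ≤ 1) (M : Finset E) (L l : ℝ)
    (hM : ∀ e ∈ M, 0 < p e ∧ 1 / p e ≤ L) (hl : |l| ≤ 1 / L) :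
    ∑ A : Finset E, sampleProb p A *
      Real.exp (l * ((∑ e ∈ A, if e ∈ M then 1 / p e else 0) - (M.card : ℝ)))
      ≤ Real.exp (l ^ 2 * L * M.card) := by
  have key : ∀ A : Finset E,
      Real.exp (l * ((∑ e ∈ A, if e ∈ M then 1 / p e else 0) - (M.card : ℝ))) =
      (∏ e ∈ A, Real.exp (l * (if e ∈ M then 1 / p e - 1 else 0))) *
        ∏ e ∈ Aᶜ, Real.exp (l * (if e ∈ M then -1 else 0)) := by
    intro A
    rw [← Real.exp_sum, ← Real.exp_sum, ← Real.exp_add]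
    congr 1
    rw [← Finset.mul_sum, ← Finset.mul_sum, ← mul_add]
    congr 1
    have hc : (M.card : ℝ) = ∑ e ∈ A, (if e ∈ M then (1:ℝ) else 0) + ∑ e ∈ Aᶜ, (if e ∈ M then (1:ℝ) else 0) := by
      rw [Finset.sum_add_sum_compl]; simp
    rw [hc, ← sub_sub, ← Finset.sum_sub_distrib, sub_eq_add_neg, ← Finset.sum_neg_distrib]
    congr 1 <;> apply Finset.sum_congr rfl <;> intro e _ <;> split_ifs <;> simp
  simp only [key]
  rw [sampleProb_mgf p]
  have : Real.exp (l ^ 2 * L * M.card) = ∏ e : E, (if e ∈ M then Real.exp (l ^ 2 * L) else 1) := by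
    rw [Finset.prod_ite_mem, Finset.univ_inter, Finset.prod_const, ← Real.exp_nat_mul]
    ring_nf
  rw [this]
  apply Finset.prod_le_prod
  · intro e _
    have := h0 e
    have := h1 e
    have : 0 ≤ 1 - p e := by linarith
    positivity
  · intro e _
    by_cases he : e ∈ M
    · simp only [he, if_true]
      exact mgf_one (p e) L l (hM e he).1 (h1 e) (hM e he).2 hl
    · simp [he]

theorem chernoff {E : Type} [Fintype E] [DecidableEq E] (p : E → ℝ)
    (h0 : ∀ e, 0 ≤ p e) (h1 : ∀ e, p e ≤ 1) (M : Finset E) (L δ B : ℝ) (hL : 0 < L)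
    (hM : ∀ e ∈ M, 0 < p e ∧ 1 / p e ≤ L) (hδ0 : 0 < δ) (hδ1 : δ ≤ 1) (hB : (M.card : ℝ) ≤ B) :
    ∑ A : Finset E, (if δ * B < |(∑ e ∈ A, if e ∈ M then 1 / p e else 0) - (M.card : ℝ)| then
      sampleProb p A else 0) ≤ 2 * Real.exp (- (δ ^ 2 * B / (4 * L))) := by
  set Z : Finset E → ℝ := fun A => (∑ e ∈ A, if e ∈ M then 1 / p e else 0) - (M.card : ℝ) with hZ
  set l := δ / (2 * L) with hl
  have hl0 : 0 < l := by positivity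
  have hlL : l ≤ 1 / L := by
    rw [hl, div_le_div_iff₀ (by positivity) hL]; nlinarith
  have hl1 : |l| ≤ 1 / L := by rwa [abs_of_pos hl0]
  have hl2 : |-l| ≤ 1 / L := by rwa [abs_neg]
  have m1 := mgf_all p h0 h1 M L l hM hl1
  have m2 := mgf_all p h0 h1 M L (-l) hM hl2
  rw [neg_sq] at m2
  have hpt : ∀ A : Finset E, (if δ * B < |Z A| then sampleProb p A else 0) ≤
      (sampleProb p A * Real.exp (l * Z A) + sampleProb p A * Real.exp (-l * Z A)) *
        Real.exp (- (l * (δ * B))) := by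
    intro A
    have hs := sampleProb_nonneg p h0 h1 A
    split_ifs with h
    · have : 1 ≤ (Real.exp (l * Z A) + Real.exp (-l * Z A)) * Real.exp (- (l * (δ * B))) := by
        rw [add_mul, ← Real.exp_add, ← Real.exp_add]
        rcases lt_abs.1 h with h | h
        · have : 1 ≤ Real.exp (l * Z A + - (l * (δ * B))) := Real.one_le_exp (by nlinarith)
          linarith [Real.exp_pos (-l * Z A + - (l * (δ * B)))]
        · have : 1 ≤ Real.exp (-l * Z A + - (l * (δ * B))) := Real.one_le_exp (by nlinarith)
          linarith [Real.exp_pos (l * Z A + - (l * (δ * B)))]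
      nlinarith
    · positivity
  refine (Finset.sum_le_sum fun A _ => hpt A).trans ?_
  rw [← Finset.sum_mul, Finset.sum_add_distrib]
  have hexp : Real.exp (l ^ 2 * L * M.card) ≤ Real.exp (l ^ 2 * L * B) := by
    apply Real.exp_le_exp.2; gcongr
  calc _ ≤ (2 * Real.exp (l ^ 2 * L * B)) * Real.exp (- (l * (δ * B))) := by
        gcongr; linarith
    _ = 2 * Real.exp (- (δ ^ 2 * B / (4 * L))) := by
        rw [mul_assoc, ← Real.exp_add]
        congr 2
        rw [hl]; field_simp; ring

theorem union_num {D : Type} (𝒟 : Finset D) (g : D → ℝ) (c : ℝ) (hc : 0 < c) (n : ℕ) (hn : 2 ≤ n)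
    (d : ℕ) (hg : ∀ x ∈ 𝒟, c ≤ g x)
    (hcount : ∀ k : ℕ, 1 ≤ k → (𝒟.filter (fun x => g x ≤ k * c / 2)).card ≤ n ^ (2 * k)) :
    ∑ x ∈ 𝒟, 2 * Real.exp (- (2 * ((d:ℝ) + 6) * Real.log n * (g x / c))) ≤
      4 / (n : ℝ) ^ (d + 1) := by
  have hn0 : (0:ℝ) < n := by positivity
  have hn2 : (2:ℝ) ≤ n := by exact_mod_cast hn
  have hlog : 0 ≤ Real.log n := Real.log_nonneg (by linarith)
  set fl : D → ℕ := fun x => ⌊g x / c⌋₊ with hfl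
  have hfl1 : ∀ x ∈ 𝒟, 1 ≤ fl x := by
    intro x hx
    rw [hfl]; simp only
    rw [Nat.one_le_floor_iff, le_div_iff₀ hc]; linarith [hg x hx]
  have hterm : ∀ x ∈ 𝒟, 2 * Real.exp (- (2 * ((d:ℝ) + 6) * Real.log n * (g x / c))) ≤
      2 / (n:ℝ) ^ (2 * (d + 6) * fl x) := by
    intro x hx
    have h1 : ((fl x : ℕ):ℝ) ≤ g x / c := Nat.floor_le (by
      have := hg x hx
      have : 0 ≤ g x := by linarith
      positivity)
    rw [div_eq_mul_inv 2]
    apply mul_le_mul_of_nonneg_left _ (by norm_num : (0:ℝ) ≤ 2)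
    rw [← Real.exp_log (pow_pos hn0 _), ← Real.exp_neg, Real.log_pow]
    apply Real.exp_le_exp.2
    push_cast
    have : 2 * ((d:ℝ) + 6) * Real.log n * (fl x) ≤ 2 * ((d:ℝ) + 6) * Real.log n * (g x / c) := by
      gcongr
    linarith
  refine (Finset.sum_le_sum hterm).trans ?_
  obtain ⟨J, hJ⟩ : ∃ J : ℕ, ∀ x ∈ 𝒟, fl x < J := by
    refine ⟨𝒟.sup fl + 1, fun x hx => Nat.lt_succ_of_le (Finset.le_sup (f := fl) hx)⟩
  rw [← Finset.sum_fiberwise_of_maps_to (s := 𝒟) (t := Finset.range J) (g := fl)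
    (fun x hx => Finset.mem_range.2 (hJ x hx))]
  have hj : ∀ j ∈ Finset.range J, ∑ x ∈ 𝒟 with fl x = j, 2 / (n:ℝ) ^ (2 * (d + 6) * fl x) ≤
      2 / (n:ℝ) ^ (d+1) * (1 / 2) ^ j := by
    intro j _
    rcases Nat.eq_zero_or_pos j with h0 | hj
    · rw [Finset.sum_eq_zero_iff_of_nonneg (fun _ _ => by positivity) |>.2]
      · positivity
      · intro x hx
        rw [Finset.mem_filter] at hx
        have := hfl1 x hx.1
        omega
    · have hcard : (𝒟.filter (fun x => fl x = j)).card ≤ n ^ (2 * (2 * (j + 1))) := by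
        refine le_trans (Finset.card_le_card ?_) (hcount (2 * (j+1)) (by omega))
        intro x hx
        rw [Finset.mem_filter] at hx ⊢
        refine ⟨hx.1, ?_⟩
        have : g x / c < fl x + 1 := Nat.lt_floor_add_one _
        rw [hx.2, div_lt_iff₀ hc] at this
        push_cast
        linarith
      calc ∑ x ∈ 𝒟 with fl x = j, 2 / (n:ℝ) ^ (2 * (d + 6) * fl x)
          = ∑ x ∈ 𝒟 with fl x = j, 2 / (n:ℝ) ^ (2 * (d + 6) * j) := by
            apply Finset.sum_congr rfl
            intro x hx
            rw [(Finset.mem_filter.1 hx).2]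
        _ = ((𝒟.filter (fun x => fl x = j)).card : ℝ) * (2 / (n:ℝ) ^ (2 * (d + 6) * j)) := by
            rw [Finset.sum_const, nsmul_eq_mul]
        _ ≤ (n:ℝ) ^ (2 * (2 * (j + 1))) * (2 / (n:ℝ) ^ (2 * (d + 6) * j)) := by
            gcongr; exact_mod_cast hcard
        _ ≤ 2 / (n:ℝ) ^ (d+1) * (1 / (n:ℝ) ^ j) := by
            rw [div_mul_div_comm, ← mul_div_assoc, div_le_div_iff₀ (by positivity) (by positivity)]
            have : (n:ℝ) ^ (2 * (2 * (j + 1)) + (d + 1) + j) ≤ (n:ℝ) ^ (2 * (d + 6) * j) := by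
              apply pow_le_pow_right₀ (by linarith)
              nlinarith
            rw [pow_add, pow_add] at this
            nlinarith
        _ ≤ _ := by
            rw [one_div_pow]
            gcongr
  refine (Finset.sum_le_sum hj).trans ?_
  rw [← Finset.mul_sum]
  have hgeo : ∑ j ∈ Finset.range J, (1 / 2 : ℝ) ^ j ≤ 2 := sum_geometric_two_le J
  calc _ ≤ 2 / (n:ℝ) ^ (d+1) * 2 := by gcongr
    _ = _ := by ring


theorem cutWt_nonneg {V F : Type} [Fintype F] (ep : F → V × V) (w : F → ℝ) (hw : ∀ f, 0 ≤ w f)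
    (X S : Finset V) : 0 ≤ cutWt ep w X S := by
  unfold cutWt
  apply Finset.sum_nonneg
  intro f _
  split_ifs
  · exact hw f
  · exact le_rfl

theorem minCutIn_nonneg {V F : Type} [Fintype F] (ep : F → V × V) (w : F → ℝ)
    (hw : ∀ f, 0 ≤ w f) (X : Finset V) : 0 ≤ minCutIn ep w X := by
  apply Real.sInf_nonneg
  rintro c ⟨S, _, _, _, rfl⟩
  exact cutWt_nonneg ep w hw X S

theorem strength_set_finite {V F : Type} [Fintype V] [Fintype F] (ep : F → V × V)
    (w : F → ℝ) (f : F) :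
    {c : ℝ | ∃ X : Finset V, (ep f).1 ∈ X ∧ (ep f).2 ∈ X ∧ c = minCutIn ep w X}.Finite := by
  apply (Set.finite_range (minCutIn ep w)).subset
  rintro c ⟨X, _, _, rfl⟩
  exact ⟨X, rfl⟩

theorem strength_nonneg {V F : Type} [Fintype V] [Fintype F] (ep : F → V × V)
    (w : F → ℝ) (hw : ∀ f, 0 ≤ w f) (f : F) : 0 ≤ strength ep w f := by
  apply Real.sSup_nonneg
  rintro c ⟨X, _, _, rfl⟩
  exact minCutIn_nonneg ep w hw X

theorem le_strength {V F : Type} [Fintype V] [Fintype F] (ep : F → V × V)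
    (w : F → ℝ) (f : F) (X : Finset V) (h1 : (ep f).1 ∈ X) (h2 : (ep f).2 ∈ X) :
    minCutIn ep w X ≤ strength ep w f :=
  le_csSup (strength_set_finite ep w f).bddAbove ⟨X, h1, h2, rfl⟩

theorem strength_wit {V F : Type} [Fintype V] [Fintype F] (ep : F → V × V)
    (w : F → ℝ) (f : F) :
    ∃ X : Finset V, (ep f).1 ∈ X ∧ (ep f).2 ∈ X ∧ strength ep w f = minCutIn ep w X :=
  Set.Nonempty.csSup_mem (s := {c : ℝ | ∃ X : Finset V, (ep f).1 ∈ X ∧ (ep f).2 ∈ X ∧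
    c = minCutIn ep w X}) ⟨_, Finset.univ, Finset.mem_univ _, Finset.mem_univ _, rfl⟩
    (strength_set_finite ep w f)

theorem minCut_le {V F : Type} [Fintype F] (ep : F → V × V)
    (w : F → ℝ) (hw : ∀ f, 0 ≤ w f) (f : F) (X S : Finset V) (h1 : (ep f).1 ∈ X)
    (h2 : (ep f).2 ∈ X) (hf : crossesCut ep S f) : minCutIn ep w X ≤ cutWt ep w X S := by
  apply csInf_le
  · refine ⟨0, ?_⟩
    rintro c ⟨S, _, _, _, rfl⟩
    exact cutWt_nonneg ep w hw X S
  · refine ⟨S ∩ X, Finset.inter_subset_right, ?_, ?_, ?_⟩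
    · rcases hf with h | h
      · exact ⟨(ep f).1, Finset.mem_inter.2 ⟨h.1, h1⟩⟩
      · exact ⟨(ep f).2, Finset.mem_inter.2 ⟨h.2, h2⟩⟩
    · intro heq
      rcases hf with h | h
      · rw [← heq] at h2; exact h.2 (Finset.mem_inter.1 h2).1
      · rw [← heq] at h1; exact h.1 (Finset.mem_inter.1 h1).1
    · unfold cutWt
      apply Finset.sum_congr rfl
      intro g _
      congr 1
      apply propext
      unfold crossesCut
      constructor
      · rintro ⟨a, b, c⟩; refine ⟨a, b, ?_⟩; simp [a, b]; exact c
      · rintro ⟨a, b, c⟩; refine ⟨a, b, ?_⟩; simp [a, b] at c; exact c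

theorem crosses_iff {V F : Type} (ep : F → V × V) (S : Finset V) (f : F) :
    crossesCut ep S f ↔ ¬ ((ep f).1 ∈ S ↔ (ep f).2 ∈ S) := by
  unfold crossesCut; tauto

theorem exists_strong {V F : Type} [Fintype V] [Fintype F] (ep : F → V × V)
    (w : F → ℝ) (hw : ∀ f, 0 ≤ w f) (τ : ℝ) (hτ : 0 < τ) (S : Finset V) (f : F)
    (hf : crossesCut ep S f) (hk : τ ≤ strength ep w f) :
    ∃ f', crossesCut ep S f' ∧ 0 < w f' ∧ τ ≤ strength ep w f' := by
  obtain ⟨X, h1, h2, hX⟩ := strength_wit ep w f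
  have hpos : 0 < cutWt ep w X S := by
    have := minCut_le ep w hw f X S h1 h2 hf
    linarith
  unfold cutWt at hpos
  obtain ⟨f', _, hf'⟩ := Finset.exists_lt_of_sum_lt (s := Finset.univ) (f := fun _ => (0:ℝ))
    (by simpa using hpos)
  split_ifs at hf' with h
  · exact ⟨f', h.2.2, hf', by have := le_strength ep w f' X h.1 h.2.1; linarith⟩
  · exact absurd hf' (lt_irrefl _)

/-- The edges of `F_{≥ i}`. -/
abbrev Strong {V F : Type} [Fintype V] [Fintype F] (ep : F → V × V) (w : F → ℝ) (τ : ℝ) : Type :=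
  {f : F // 0 < w f ∧ τ ≤ strength ep w f}

/-- The rescaled weights. -/
noncomputable def wI {V F : Type} [Fintype V] [Fintype F] (ep : F → V × V) (w : F → ℝ) (ρ : ℝ)
    (i : ℕ) (f : F) : ℝ :=
  w f * (2:ℝ) ^ ((i : ℤ) - Int.log 2 (strength ep w f / ρ))

theorem wI_nonneg {V F : Type} [Fintype V] [Fintype F] (ep : F → V × V) (w : F → ℝ)
    (hw : ∀ f, 0 ≤ w f) (ρ : ℝ) (i : ℕ) (f : F) : 0 ≤ wI ep w ρ i f :=
  mul_nonneg (hw f) (by positivity)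

theorem strong_sum {V F : Type} [Fintype V] [Fintype F] (ep : F → V × V)
    (w : F → ℝ) (τ : ℝ) (S : Finset V) (h : F → ℝ) :
    ∑ f ∈ dl (fun f : Strong ep w τ => (ep f.1).1) (fun f => (ep f.1).2) S, h f.1 =
      ∑ g : F, if (0 < w g ∧ τ ≤ strength ep w g) ∧ crossesCut ep S g then h g else 0 := by
  have h1 : ∑ f ∈ dl (fun f : Strong ep w τ => (ep f.1).1) (fun f => (ep f.1).2) S, h f.1 =
      ∑ f : Strong ep w τ, if crossesCut ep S f.1 then h f.1 else 0 := by
    rw [← Finset.sum_filter]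
    apply Finset.sum_congr _ (fun _ _ => rfl)
    ext g
    rw [mem_dl]; simp [crosses_iff]
  rw [h1]
  simp only [ite_and]
  rw [← Finset.sum_subtype (Finset.univ.filter (fun g => 0 < w g ∧ τ ≤ strength ep w g))
    (p := fun g => 0 < w g ∧ τ ≤ strength ep w g) (by simp)
    (fun g => if crossesCut ep S g then h g else 0), Finset.sum_filter]
  simp only [ite_and]

theorem strong_mincut {V F : Type} [Fintype V] [Fintype F] (ep : F → V × V)
    (w : F → ℝ) (hw : ∀ f, 0 ≤ w f) (ρ : ℝ) (hρ : 0 < ρ) (i : ℕ) (S : Finset V) :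
    dl (fun f : Strong ep w (ρ * 2 ^ i) => (ep f.1).1) (fun f => (ep f.1).2) S = ∅ ∨
      ρ * 2 ^ i ≤ ∑ f ∈ dl (fun f : Strong ep w (ρ * 2 ^ i) => (ep f.1).1)
        (fun f => (ep f.1).2) S, wI ep w ρ i f.1 := by
  set D := dl (fun f : Strong ep w (ρ * 2 ^ i) => (ep f.1).1) (fun f => (ep f.1).2) S with hD
  rcases Finset.eq_empty_or_nonempty D with h | h
  · exact Or.inl h
  right
  obtain ⟨f, hfD, hmax⟩ := Finset.exists_max_image D (fun f => strength ep w f.1) h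
  obtain ⟨X, h1, h2, hX⟩ := strength_wit ep w f.1
  have hfc : crossesCut ep S f.1 := by rw [crosses_iff]; rw [hD, mem_dl] at hfD; exact hfD
  have hτ : 0 < ρ * 2 ^ i := by positivity
  have hk : 0 < strength ep w f.1 := lt_of_lt_of_le hτ f.2.2
  have hcut := minCut_le ep w hw f.1 X S h1 h2 hfc
  rw [← hX] at hcut
  set j := Int.log 2 (strength ep w f.1 / ρ) with hj
  have hjle : (2:ℝ) ^ j ≤ strength ep w f.1 / ρ := by
    have := Int.zpow_log_le_self (b := 2) (r := strength ep w f.1 / ρ) (by norm_num) (by positivity)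
    simpa using this
  have hsum : (2:ℝ) ^ ((i:ℤ) - j) * cutWt ep w X S ≤ ∑ f ∈ D, wI ep w ρ i f.1 := by
    have e1 := strong_sum ep w (ρ * 2 ^ i) S (wI ep w ρ i)
    rw [← hD] at e1
    rw [e1, cutWt, Finset.mul_sum]
    apply Finset.sum_le_sum
    intro g _
    have hwg := hw g
    have hIg := wI_nonneg ep w hw ρ i g
    by_cases hg : (ep g).1 ∈ X ∧ (ep g).2 ∈ X ∧ crossesCut ep S g
    · rw [if_pos hg]
      rcases hwg.eq_or_lt with h0 | h0
      · rw [← h0]; simp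
      · have hkg : strength ep w f.1 ≤ strength ep w g := by
          rw [hX]; exact le_strength ep w g X hg.1 hg.2.1
        have hcond : 0 < w g ∧ ρ * 2 ^ i ≤ strength ep w g := ⟨h0, f.2.2.trans hkg⟩
        rw [if_pos ⟨hcond, hg.2.2⟩]
        have hle : strength ep w g ≤ strength ep w f.1 := by
          refine hmax ⟨g, hcond⟩ ?_
          rw [hD, mem_dl]
          exact (crosses_iff ep S g).1 hg.2.2
        rw [wI, hj, le_antisymm hle hkg, mul_comm]
    · rw [if_neg hg, mul_zero]
      split_ifs <;> first | exact hIg | exact le_rfl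
  refine le_trans ?_ hsum
  calc ρ * 2 ^ i = (2:ℝ) ^ ((i:ℤ) - j) * (ρ * (2:ℝ) ^ j) := by
        rw [zpow_sub₀ (by norm_num), zpow_natCast]; field_simp
    _ ≤ (2:ℝ) ^ ((i:ℤ) - j) * strength ep w f.1 := by
        gcongr
        rw [le_div_iff₀ hρ] at hjle; linarith
    _ ≤ _ := by gcongr

theorem hCrosses_iff {V E : Type} (he : E → Finset V) (S : Finset V) (e : E) :
    hCrosses he S e ↔ (∃ u, u ∈ he e ∧ u ∈ S) ∧ (∃ v, v ∈ he e ∧ v ∉ S) := by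
  simp [hCrosses, Finset.Nonempty]

theorem kappa_nonneg {V E : Type} [Fintype V] [LinearOrder V] [Fintype E]
    (he : E → Finset V) (w : CliqueEdges he → ℝ) (hw : ∀ f, 0 ≤ w f) (e : E) :
    0 ≤ kappa he w e := by
  apply Real.sInf_nonneg
  rintro c ⟨f, _, rfl⟩
  exact strength_nonneg _ w hw f

theorem kappa_le {V E : Type} [Fintype V] [LinearOrder V] [Fintype E]
    (he : E → Finset V) (w : CliqueEdges he → ℝ) (hw : ∀ f, 0 ≤ w f) (f : CliqueEdges he) :
    kappa he w f.1.1 ≤ strength (cep he) w f := by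
  apply csInf_le
  · refine ⟨0, ?_⟩
    rintro c ⟨f, _, rfl⟩
    exact strength_nonneg _ w hw f
  · exact ⟨f, rfl, rfl⟩

theorem le_kappaMax {V E : Type} [Fintype V] [LinearOrder V] [Fintype E]
    (he : E → Finset V) (w : CliqueEdges he → ℝ) (f : CliqueEdges he) (hf : 0 < w f) :
    strength (cep he) w f ≤ kappaMax he w f.1.1 := by
  apply le_csSup
  · apply Set.Finite.bddAbove
    apply (Set.finite_range (strength (cep he) w)).subset
    rintro c ⟨f, _, _, rfl⟩
    exact ⟨f, rfl⟩
  · exact ⟨f, rfl, hf, rfl⟩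

theorem kappa_le_kappaMax {V E : Type} [Fintype V] [LinearOrder V] [Fintype E]
    (he : E → Finset V) (w : CliqueEdges he → ℝ) (hw : ∀ f, 0 ≤ w f) (γ : ℝ)
    (hbal : BalancedAssignment he w γ) (e : E) : kappa he w e ≤ kappaMax he w e := by
  have h1 := (hbal e).1
  obtain ⟨f, _, hf⟩ := Finset.exists_lt_of_sum_lt (s := Finset.univ) (f := fun _ => (0:ℝ))
    (g := fun f : CliqueEdges he => if f.1.1 = e then w f else 0) (by rw [h1]; simp)
  split_ifs at hf with h
  · subst h
    exact (kappa_le he w hw f).trans (le_kappaMax he w f hf)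
  · exact absurd hf (lt_irrefl _)

theorem hcross_of {V E : Type} [Fintype V] [LinearOrder V] [Fintype E]
    (he : E → Finset V) (S : Finset V) (f : CliqueEdges he) (hf : crossesCut (cep he) S f) :
    hCrosses he S f.1.1 := by
  obtain ⟨h1, h2, _⟩ := f.2
  rw [hCrosses_iff]
  rcases hf with h | h
  · exact ⟨⟨_, h1, h.1⟩, ⟨_, h2, h.2⟩⟩
  · exact ⟨⟨_, h2, h.2⟩, ⟨_, h1, h.1⟩⟩

theorem exists_cross {V E : Type} [Fintype V] [LinearOrder V] [Fintype E]
    (he : E → Finset V) (S : Finset V) (e : E) (h : hCrosses he S e) :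
    ∃ f : CliqueEdges he, f.1.1 = e ∧ crossesCut (cep he) S f := by
  rw [hCrosses_iff] at h
  obtain ⟨⟨u, hu⟩, ⟨v, hv⟩⟩ := h
  have hne : u ≠ v := by rintro rfl; exact hv.2 hu.2
  rcases lt_or_gt_of_ne hne with h | h
  · exact ⟨⟨(e, u, v), hu.1, hv.1, h⟩, rfl, Or.inl ⟨hu.2, hv.2⟩⟩
  · exact ⟨⟨(e, v, u), hv.1, hu.1, h⟩, rfl, Or.inr ⟨hv.2, hu.2⟩⟩

theorem hcross_class {V E : Type} [Fintype V] [LinearOrder V] [Fintype E]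
    (he : E → Finset V) (w : CliqueEdges he → ℝ) (hw : ∀ f, 0 ≤ w f) (τ : ℝ) (hτ : 0 < τ)
    (S T : Finset V)
    (hST : dl (fun f : Strong (cep he) w τ => (cep he f.1).1) (fun f => (cep he f.1).2) S =
      dl (fun f : Strong (cep he) w τ => (cep he f.1).1) (fun f => (cep he f.1).2) T)
    (e : E) (hκ : τ ≤ kappa he w e) (hS : hCrosses he S e) : hCrosses he T e := by
  by_contra hT
  obtain ⟨f, rfl, hf⟩ := exists_cross he S e hS
  have hfT : ¬ crossesCut (cep he) T f := fun h => hT (hcross_of he T f h)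
  have hmem : ∀ x, x ∈ Finset.univ.filter (fun x => ¬ (x ∈ S ↔ x ∈ T)) ↔ ¬ (x ∈ S ↔ x ∈ T) := by
    simp
  obtain ⟨f', h1, h2, h3⟩ := exists_strong (cep he) w hw τ hτ
    (Finset.univ.filter (fun x => ¬ (x ∈ S ↔ x ∈ T))) f (by
      rw [crosses_iff] at hf hfT ⊢
      rw [hmem, hmem]
      tauto) (hκ.trans (kappa_le he w hw f))
  have hff := Finset.ext_iff.1 hST ⟨f', h2, h3⟩
  rw [mem_dl, mem_dl] at hff
  simp only at hff
  rw [crosses_iff, hmem, hmem] at h1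
  tauto

theorem card_le_X {V E : Type} [Fintype V] [LinearOrder V] [Fintype E]
    (he : E → Finset V) (w : CliqueEdges he → ℝ) (hw : ∀ f, 0 ≤ w f) (γ : ℝ) (hγ : 1 ≤ γ)
    (hbal : BalancedAssignment he w γ) (ρ : ℝ) (hρ : 0 < ρ) (i : ℕ) (S : Finset V) :
    ((Finset.univ.filter (fun e => hCrosses he S e ∧ ρ * 2 ^ i ≤ kappa he w e ∧
                  kappa he w e < ρ * 2 ^ (i + 1))).card : ℝ) ≤
    ∑ e : E, if hCrosses he S e ∧ ρ * 2 ^ i ≤ kappaMax he w e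
                  then (2 : ℝ) ^ ((i : ℤ) - Int.log 2 (kappa he w e / ρ)) else 0 := by
  rw [Finset.card_filter]
  push_cast
  apply Finset.sum_le_sum
  intro e _
  by_cases h : hCrosses he S e ∧ ρ * 2 ^ i ≤ kappa he w e ∧ kappa he w e < ρ * 2 ^ (i + 1)
  · rw [if_pos h, if_pos ⟨h.1, h.2.1.trans (kappa_le_kappaMax he w hw γ hbal e)⟩]
    apply one_le_zpow₀ (by norm_num)
    have hpos : 0 < kappa he w e := lt_of_lt_of_le (by positivity) h.2.1
    have : Int.log 2 (kappa he w e / ρ) < (i:ℤ) + 1 := by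
      rw [← Int.lt_zpow_iff_log_lt (by norm_num) (by positivity), div_lt_iff₀ hρ]
      have := h.2.2
      rw [show ((i:ℤ) + 1) = ((i+1 : ℕ) : ℤ) by push_cast; rfl, zpow_natCast]
      push_cast
      linarith
    omega
  · rw [if_neg h]
    split_ifs
    · positivity
    · exact le_rfl

theorem g_le_X {V E : Type} [Fintype V] [LinearOrder V] [Fintype E]
    (he : E → Finset V) (w : CliqueEdges he → ℝ) (hw : ∀ f, 0 ≤ w f) (γ : ℝ) (hγ : 1 ≤ γ)
    (hbal : BalancedAssignment he w γ) (ρ : ℝ) (hρ : 0 < ρ) (i : ℕ) (S : Finset V) :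
    ∑ f ∈ dl (fun f : Strong (cep he) w (ρ * 2 ^ i) => (cep he f.1).1)
      (fun f => (cep he f.1).2) S, wI (cep he) w ρ i f.1 ≤
    ∑ e : E, if hCrosses he S e ∧ ρ * 2 ^ i ≤ kappaMax he w e
                  then (2 : ℝ) ^ ((i : ℤ) - Int.log 2 (kappa he w e / ρ)) else 0 := by
  have hτ0 : 0 < ρ * 2 ^ i := by positivity
  rw [strong_sum (cep he) w (ρ * 2 ^ i) S (wI (cep he) w ρ i)]
  have hsplit : ∀ a : CliqueEdges he → ℝ, ∑ f, a f = ∑ e : E, ∑ f, if f.1.1 = e then a f else 0 := by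
    intro a
    rw [Finset.sum_comm]
    apply Finset.sum_congr rfl
    intro f _
    simp
  rw [hsplit]
  apply Finset.sum_le_sum
  intro e _
  by_cases hc : hCrosses he S e ∧ ρ * 2 ^ i ≤ kappaMax he w e
  · rw [if_pos hc]
    have hκ0 : 0 < kappa he w e := by
      have h1 := (hbal e).2
      have : 0 < γ * kappa he w e := by linarith [hc.2]
      exact pos_of_mul_pos_right this (by linarith)
    calc _ ≤ ∑ f : CliqueEdges he, (if f.1.1 = e then w f else 0) *
          (2 : ℝ) ^ ((i : ℤ) - Int.log 2 (kappa he w e / ρ)) := by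
          apply Finset.sum_le_sum
          intro f _
          by_cases hfe : f.1.1 = e
          · rw [if_pos hfe, if_pos hfe]
            split_ifs with h
            · unfold wI
              apply mul_le_mul_of_nonneg_left _ (hw f)
              apply zpow_le_zpow_right₀ (by norm_num)
              have hk := kappa_le he w hw f
              rw [hfe] at hk
              have : Int.log 2 (kappa he w e / ρ) ≤ Int.log 2 (strength (cep he) w f / ρ) := by
                apply Int.log_mono_right (by positivity)
                gcongr
              omega
            · have := hw f
              positivity
          · simp [hfe]
      _ = _ := by rw [← Finset.sum_mul, (hbal e).1, one_mul]
  · rw [if_neg hc]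
    apply le_of_eq
    apply Finset.sum_eq_zero
    intro f _
    by_cases hfe : f.1.1 = e
    · rw [if_pos hfe, if_neg]
      rintro ⟨⟨h1, h2⟩, h3⟩
      subst hfe
      exact hc ⟨hcross_of he S f h3, h2.trans (le_kappaMax he w f h1)⟩
    · rw [if_neg hfe]

/-- In the setting of the sampling scheme (`p_e = min(1, ρ/κ_e)`,
`ρ = 8(d+6)γ²·log n/(0.38 ε²)`), fix an integer `i ≥ 0`.  Here `e ∈ E_i` iff
`ρ·2^i ≤ κ_e < ρ·2^{i+1}`, `e ∈ E_{≥i}^max` iff `κ_e^max ≥ ρ·2^i`, and for `e` with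
`ρ·2^j ≤ κ_e < ρ·2^{j+1}` we have `w_i^E(e) = 2^{i−j}`, formalized via
`j = Int.log 2 (κ_e/ρ)`.  With probability at least `1 − 4n^{−(d+1)}`, for every cut `S` the
sampled weight of the crossing hyperedges of `E_i` differs from their number by at most
`(ε/γ)·Σ_{e ∈ E_{≥i}^max crossing S} w_i^E(e)`. -/
theorem stmt10 {V E : Type} [Fintype V] [LinearOrder V] [Fintype E] [DecidableEq E]
    (he : E → Finset V) (hhe : ∀ e, 2 ≤ (he e).card)
    (hV : 2 ≤ Fintype.card V)
    (w : CliqueEdges he → ℝ) (hw : ∀ f, 0 ≤ w f)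
    (γ : ℝ) (hγ : 1 ≤ γ) (hbal : BalancedAssignment he w γ)
    (ε : ℝ) (hε0 : 0 < ε) (hε1 : ε ≤ 1)
    (d : ℕ) (hd : 1 ≤ d)
    (ρ : ℝ)
    (hρ : ρ = 8 * ((d : ℝ) + 6) * γ ^ 2 * Real.log (Fintype.card V) / (0.38 * ε ^ 2))
    (p : E → ℝ) (hp : ∀ e, p e = min 1 (ρ / kappa he w e))
    (i : ℕ) :
    1 - 4 / (Fintype.card V : ℝ) ^ (d + 1) ≤
      ∑ A ∈ Finset.univ.filter (fun A : Finset E =>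
          ∀ S : Finset V, S.Nonempty → S ≠ Finset.univ →
            |(∑ e ∈ A, if hCrosses he S e ∧ ρ * 2 ^ i ≤ kappa he w e ∧
                  kappa he w e < ρ * 2 ^ (i + 1) then 1 / p e else 0) -
                ((Finset.univ.filter (fun e => hCrosses he S e ∧ ρ * 2 ^ i ≤ kappa he w e ∧
                  kappa he w e < ρ * 2 ^ (i + 1))).card : ℝ)|
              ≤ (ε / γ) *
                ∑ e : E, if hCrosses he S e ∧ ρ * 2 ^ i ≤ kappaMax he w e
                  then (2 : ℝ) ^ ((i : ℤ) - Int.log 2 (kappa he w e / ρ)) else 0),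
        sampleProb p A := by
  have hn2 : (2:ℝ) ≤ (Fintype.card V : ℝ) := by exact_mod_cast hV
  have hlog : 0 < Real.log (Fintype.card V) := Real.log_pos (by linarith)
  have hγ0 : 0 < γ := by linarith
  have hρ0 : 0 < ρ := by rw [hρ]; positivity
  have hτ0 : 0 < ρ * 2 ^ i := by positivity
  set δ := ε / γ with hδ
  have hδ0 : 0 < δ := by positivity
  have hδ1 : δ ≤ 1 := by rw [hδ, div_le_one hγ0]; linarith
  have hp0 : ∀ e, 0 ≤ p e := by
    intro e
    rw [hp]
    have := kappa_nonneg he w hw e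
    positivity
  have hp1 : ∀ e, p e ≤ 1 := by intro e; rw [hp]; exact min_le_left _ _
  let sF : Strong (cep he) w (ρ * 2 ^ i) → V := fun f => (cep he f.1).1
  let tF : Strong (cep he) w (ρ * 2 ^ i) → V := fun f => (cep he f.1).2
  let wF : Strong (cep he) w (ρ * 2 ^ i) → ℝ := fun f => wI (cep he) w ρ i f.1
  have hmin : ∀ S, dl sF tF S = ∅ ∨ ρ * 2 ^ i ≤ ∑ f ∈ dl sF tF S, wF f :=
    strong_mincut (cep he) w hw ρ hρ0 i
  let inE : E → Prop := fun e => ρ * 2 ^ i ≤ kappa he w e ∧ kappa he w e < ρ * 2 ^ (i + 1)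
  let MS : Finset V → Finset E := fun S => Finset.univ.filter (fun e => hCrosses he S e ∧ inE e)
  have hclass : ∀ S T, dl sF tF S = dl sF tF T → MS S ⊆ MS T := by
    intro S T hST e heS
    simp only [MS, Finset.mem_filter, Finset.mem_univ, true_and] at heS ⊢
    exact ⟨hcross_class he w hw (ρ * 2 ^ i) hτ0 S T hST e heS.2.1 heS.1, heS.2⟩
  let MD : Finset (Strong (cep he) w (ρ * 2 ^ i)) → Finset E := fun D =>
    Finset.univ.filter (fun e => ∃ S, dl sF tF S = D ∧ e ∈ MS S)
  have hMD : ∀ S, MD (dl sF tF S) = MS S := by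
    intro S
    ext e
    simp only [MD, Finset.mem_filter, Finset.mem_univ, true_and]
    constructor
    · rintro ⟨T, hT, h⟩
      exact hclass T S hT h
    · intro h; exact ⟨S, rfl, h⟩
  have hME : ∀ D, ∀ e ∈ MD D, inE e := by
    intro D e h
    simp only [MD, MS, Finset.mem_filter, Finset.mem_univ, true_and] at h
    obtain ⟨S, _, h⟩ := h
    exact h.2
  let g : Finset (Strong (cep he) w (ρ * 2 ^ i)) → ℝ := fun D => ∑ f ∈ D, wF f
  let 𝒟 := (Finset.univ.image (dl sF tF)).filter (fun D => D ≠ ∅)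
  let B : Finset (Strong (cep he) w (ρ * 2 ^ i)) → ℝ := fun D => max ((MD D).card : ℝ) (g D)
  let X : Finset V → ℝ := fun S => ∑ e : E, if hCrosses he S e ∧ ρ * 2 ^ i ≤ kappaMax he w e
                  then (2 : ℝ) ^ ((i : ℤ) - Int.log 2 (kappa he w e / ρ)) else 0
  have hX0 : ∀ S, 0 ≤ X S := by
    intro S
    apply Finset.sum_nonneg
    intro e _
    split_ifs
    · positivity
    · exact le_rfl
  have hBX : ∀ S, B (dl sF tF S) ≤ X S := by
    intro S
    apply max_le
    · rw [hMD]
      exact card_le_X he w hw γ hγ hbal ρ hρ0 i S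
    · exact g_le_X he w hw γ hγ hbal ρ hρ0 i S
  have hbad : ∀ D ∈ 𝒟, ∑ A : Finset E, (if δ * B D <
      |(∑ e ∈ A, if e ∈ MD D then 1 / p e else 0) - ((MD D).card : ℝ)| then
      sampleProb p A else 0) ≤
      2 * Real.exp (- (2 * ((d:ℝ) + 6) * Real.log (Fintype.card V) * (g D / (ρ * 2 ^ i)))) := by
    intro D hD
    refine (chernoff p hp0 hp1 (MD D) (2 ^ (i+1)) δ (B D) (by positivity) ?_ hδ0 hδ1
      (le_max_left _ _)).trans ?_
    · intro e heD
      have hE := hME D e heD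
      have h2i : (1:ℝ) ≤ 2 ^ i := one_le_pow₀ (by norm_num)
      have hκ : ρ ≤ kappa he w e := by
        have := hE.1
        nlinarith
      have hκ0 : 0 < kappa he w e := by linarith
      have hpe : p e = ρ / kappa he w e := by
        rw [hp]; apply min_eq_right; rw [div_le_one hκ0]; exact hκ
      rw [hpe]
      refine ⟨by positivity, ?_⟩
      rw [one_div_div, div_le_iff₀ hρ0]
      linarith [hE.2]
    · apply mul_le_mul_of_nonneg_left _ (by norm_num : (0:ℝ) ≤ 2)
      apply Real.exp_le_exp.2
      apply neg_le_neg
      have hg0 : 0 ≤ g D := Finset.sum_nonneg fun f _ => wI_nonneg _ _ hw _ _ _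
      have hgB : g D ≤ B D := le_max_right _ _
      have hnum : 16 * ((d:ℝ) + 6) * Real.log (Fintype.card V) ≤ δ ^ 2 * ρ := by
        have : δ ^ 2 * ρ = (8 / 0.38) * (((d:ℝ) + 6) * Real.log (Fintype.card V)) := by
          rw [hδ, hρ]; field_simp
        rw [this]
        have h3 : 0 ≤ ((d:ℝ) + 6) * Real.log (Fintype.card V) := by positivity
        have : (16:ℝ) ≤ 8 / 0.38 := by norm_num
        nlinarith
      calc 2 * ((d:ℝ) + 6) * Real.log (Fintype.card V) * (g D / (ρ * 2 ^ i))
          = (16 * ((d:ℝ) + 6) * Real.log (Fintype.card V)) * (g D / (8 * ρ * 2 ^ i)) := by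
            field_simp; ring
        _ ≤ (δ ^ 2 * ρ) * (g D / (8 * ρ * 2 ^ i)) := by gcongr
        _ = δ ^ 2 * g D / (4 * 2 ^ (i+1)) := by rw [pow_succ]; field_simp; ring
        _ ≤ _ := by gcongr
  have hsum : ∑ D ∈ 𝒟, ∑ A : Finset E, (if δ * B D <
      |(∑ e ∈ A, if e ∈ MD D then 1 / p e else 0) - ((MD D).card : ℝ)| then
      sampleProb p A else 0) ≤ 4 / (Fintype.card V : ℝ) ^ (d + 1) := by
    refine (Finset.sum_le_sum hbad).trans ?_
    refine union_num 𝒟 g (ρ * 2 ^ i) hτ0 (Fintype.card V) hV d ?_ ?_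
    · intro D hD
      simp only [𝒟, Finset.mem_filter, Finset.mem_image, Finset.mem_univ, true_and] at hD
      obtain ⟨⟨S, rfl⟩, hne⟩ := hD
      exact (hmin S).resolve_left hne
    · intro k hk
      refine le_trans (Finset.card_le_card ?_) (cut_count' wF (fun f => wI_nonneg _ _ hw _ _ _)
        (ρ * 2 ^ i) hτ0 k hk sF tF hV hmin)
      intro D hD
      rw [mem_cuts]
      simp only [𝒟, Finset.mem_filter, Finset.mem_image, Finset.mem_univ, true_and] at hD
      exact ⟨hD.1.1, hD.2⟩
  have htot := sampleProb_sum p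
  rw [← Finset.sum_filter_add_sum_filter_not Finset.univ (fun A : Finset E =>
          ∀ S : Finset V, S.Nonempty → S ≠ Finset.univ →
            |(∑ e ∈ A, if hCrosses he S e ∧ ρ * 2 ^ i ≤ kappa he w e ∧
                  kappa he w e < ρ * 2 ^ (i + 1) then 1 / p e else 0) -
                ((Finset.univ.filter (fun e => hCrosses he S e ∧ ρ * 2 ^ i ≤ kappa he w e ∧
                  kappa he w e < ρ * 2 ^ (i + 1))).card : ℝ)|
              ≤ δ *
                ∑ e : E, if hCrosses he S e ∧ ρ * 2 ^ i ≤ kappaMax he w e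
                  then (2 : ℝ) ^ ((i : ℤ) - Int.log 2 (kappa he w e / ρ)) else 0)] at htot
  rw [tsub_le_iff_right]
  refine le_trans htot.ge ?_
  refine add_le_add_right (le_trans ?_ hsum) _
  rw [Finset.sum_comm, Finset.sum_filter]
  apply Finset.sum_le_sum
  intro A _
  have hs := sampleProb_nonneg p hp0 hp1 A
  have hnn : ∀ D ∈ 𝒟, 0 ≤ (if δ * B D <
      |(∑ e ∈ A, if e ∈ MD D then 1 / p e else 0) - ((MD D).card : ℝ)| then
      sampleProb p A else 0) := by
    intro D _
    split_ifs
    · exact hs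
    · exact le_rfl
  split_ifs with hA
  · exact Finset.sum_nonneg hnn
  · push Not at hA
    obtain ⟨S, _, _, hS⟩ := hA
    have hS' : δ * X S < |(∑ e ∈ A, if e ∈ MS S then 1 / p e else 0) - ((MS S).card : ℝ)| := by
      simpa only [X, MS, inE, Finset.mem_filter, Finset.mem_univ, true_and] using hS
    have hD : dl sF tF S ∈ 𝒟 := by
      simp only [𝒟, Finset.mem_filter, Finset.mem_image, Finset.mem_univ, true_and]
      refine ⟨⟨S, rfl⟩, ?_⟩
      intro hemp
      have h0 : dl sF tF S = dl sF tF ∅ := by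
        rw [hemp]; ext f; simp [mem_dl]
      have hM : MS S = ∅ := by
        apply Finset.subset_empty.1
        refine (hclass S ∅ h0).trans ?_
        intro e h
        simp [MS, hCrosses] at h
      rw [hM] at hS'
      have := mul_nonneg hδ0.le (hX0 S)
      simp at hS'
      linarith
    refine le_trans ?_ (Finset.single_le_sum hnn hD)
    rw [if_pos]
    rw [hMD]
    refine lt_of_le_of_lt ?_ hS'
    exact mul_le_mul_of_nonneg_left (hBX S) hδ0.le
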